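/- (Proposition 3.4) Let n ≥ 1 and let 𝒰 = 𝒥·𝒟·𝒩⁻¹·𝒟 as below. Then dim_ℝ K(2n−1) = n if and only if for every n×n real matrix C there exist two upper-triangular n×n real matrices X and Y such that 𝒰·X − Yᵀ·𝒰ᵀ = C. -/

import Mathlib

open MvPolynomial

noncomputable section

/-- The polynomial ring `R = ℝ[x,y,z]`, with `x = X 0`, `y = X 1`, `z = X 2`. -/
abbrev R3 : Type := MvPolynomial (Fin 3) ℝ

/-- `J₁(r) = ⟨x^{r+1}, (x+y)^{r+1}⟩`. -/
def J1 (r : ℕ) : Ideal R3 :=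
  Ideal.span {(X 0 : R3) ^ (r + 1), ((X 0 : R3) + X 1) ^ (r + 1)}

/-- `J₂(r) = ⟨z^{r+1}, (z+y)^{r+1}⟩`. -/
def J2 (r : ℕ) : Ideal R3 :=
  Ideal.span {(X 2 : R3) ^ (r + 1), ((X 2 : R3) + X 1) ^ (r + 1)}

/-- `K(r)`: the ℝ-vector space of homogeneous polynomials `F` of degree `r` with
`y^{r+1}·F ∈ J₁(r) ∩ J₂(r)`, i.e. the degree-`r` homogeneous component of the
colon ideal `(J₁(r) ∩ J₂(r)) : ⟨y^{r+1}⟩`. -/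
def K (r : ℕ) : Submodule ℝ R3 :=
  (homogeneousSubmodule (Fin 3) ℝ r) ⊓
    (Submodule.comap (LinearMap.mulLeft ℝ ((X 1 : R3) ^ (r + 1)))
      ((J1 r ⊓ J2 r).restrictScalars ℝ))
open Matrix


/-- `𝒩`: the `n × n` real matrix with entries `𝒩_{i,j} = C(2n, n+i−j)`
(here `n + i − j ≥ 1 > 0` always, so the `ℓ < 0` convention is not needed);
its determinant is positive, so `𝒩` is invertible. -/
def Nmat (n : ℕ) : Matrix (Fin n) (Fin n) ℝ :=
  Matrix.of fun i j => ((2 * n).choose (n + (i : ℕ) - (j : ℕ)) : ℝ)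

/-- `𝒟`: the `n × n` lower-triangular matrix with `𝒟_{i,j} = C(2n, i−j)` for
`i ≥ j` and `0` otherwise. -/
def Dmat (n : ℕ) : Matrix (Fin n) (Fin n) ℝ :=
  Matrix.of fun i j =>
    if (j : ℕ) ≤ (i : ℕ) then ((2 * n).choose ((i : ℕ) - (j : ℕ)) : ℝ) else 0

/-- `𝒥`: the `n × n` exchange matrix, `𝒥_{i,j} = 1` if `i + j = n − 1` and `0`
otherwise. -/
def Jmat (n : ℕ) : Matrix (Fin n) (Fin n) ℝ :=
  Matrix.of fun i j => if (i : ℕ) + (j : ℕ) = n - 1 then 1 else 0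

/-- `𝒰 = 𝒥·𝒟·𝒩⁻¹·𝒟`. -/
def Umat (n : ℕ) : Matrix (Fin n) (Fin n) ℝ :=
  Jmat n * Dmat n * (Nmat n)⁻¹ * Dmat n

/-! ### One-variable part -/

/-- The Euler operator. -/
def theta (p : Polynomial ℝ) : Polynomial ℝ := Polynomial.X * Polynomial.derivative p

lemma theta_coeff (p : Polynomial ℝ) (k : ℕ) : (theta p).coeff k = k * p.coeff k := by
  unfold theta
  cases k with
  | zero => simp
  | succ k =>
    rw [Polynomial.coeff_X_mul, Polynomial.coeff_derivative]
    push_cast; ring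

lemma theta_iter_coeff (p : Polynomial ℝ) (m k : ℕ) :
    (theta^[m] p).coeff k = (k : ℝ) ^ m * p.coeff k := by
  induction m generalizing p with
  | zero => simp
  | succ m ih =>
    rw [Function.iterate_succ_apply, ih, theta_coeff]; ring

lemma theta_dvd (p : Polynomial ℝ) (m : ℕ)
    (h : (1 + Polynomial.X : Polynomial ℝ) ^ (m + 1) ∣ p) :
    (1 + Polynomial.X : Polynomial ℝ) ^ m ∣ theta p := by
  obtain ⟨q, rfl⟩ := h
  unfold theta
  rw [Polynomial.derivative_mul, Polynomial.derivative_pow_succ]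
  simp only [Polynomial.derivative_add, Polynomial.derivative_one, Polynomial.derivative_X]
  refine Dvd.intro (Polynomial.X * (Polynomial.C ((m : ℝ) + 1) * q +
    (1 + Polynomial.X) * Polynomial.derivative q)) ?_
  ring

lemma theta_iter_eval (p : Polynomial ℝ) (m k : ℕ) (hk : k < m)
    (h : (1 + Polynomial.X : Polynomial ℝ) ^ m ∣ p) :
    (theta^[k] p).eval (-1) = 0 := by
  induction k generalizing p m with
  | zero =>
    obtain ⟨q, rfl⟩ := h
    simp [show m ≠ 0 by omega]
  | succ k ih =>
    rw [Function.iterate_succ_apply]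
    obtain ⟨m, rfl⟩ : ∃ m', m = m' + 1 := ⟨m - 1, by omega⟩
    exact ih _ m (by omega) (theta_dvd p m h)

/-- A polynomial with at most `m` terms divisible by `(1+t)^m` vanishes. -/
lemma sparse_zero (p : Polynomial ℝ) (m : ℕ) (e : Fin m → ℕ) (he : Function.Injective e)
    (hp : ∀ k, k ∉ Set.range e → p.coeff k = 0)
    (h : (1 + Polynomial.X : Polynomial ℝ) ^ m ∣ p) : p = 0 := by
  have key : (fun j : Fin m => p.coeff (e j) * (-1) ^ (e j)) = 0 := by
    apply Matrix.eq_zero_of_forall_pow_sum_mul_pow_eq_zero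
      (f := fun j : Fin m => ((e j : ℕ) : ℝ)) (fun a b hab => he (Nat.cast_injective (R := ℝ) hab))
    intro i
    have h1 := theta_iter_eval p m i i.2 h
    rw [Polynomial.eval_eq_sum, Polynomial.sum_def,
      Finset.sum_subset (s₂ := Finset.univ.image e)] at h1
    · rw [Finset.sum_image (fun a _ b _ hab => he hab)] at h1
      rw [← h1]
      refine Finset.sum_congr rfl fun j _ => ?_
      rw [theta_iter_coeff]; ring
    · intro k hk
      rw [Polynomial.mem_support_iff, theta_iter_coeff] at hk
      by_contra hne
      exact hk (by rw [hp k (by simpa using hne)]; simp)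
    · intro k _ hk
      rw [Polynomial.notMem_support_iff.mp hk]; simp
  ext k
  by_cases hk : k ∈ Set.range e
  · obtain ⟨j, rfl⟩ := hk
    have := congrFun key j
    simpa using this
  · simpa using hp k hk

/-- Exponents in `[0,n) ∪ [2n,3n)`. -/
lemma gap_zero (n : ℕ) (p : Polynomial ℝ)
    (hp1 : ∀ k, n ≤ k → k < 2 * n → p.coeff k = 0)
    (hp2 : ∀ k, 3 * n ≤ k → p.coeff k = 0)
    (h : (1 + Polynomial.X : Polynomial ℝ) ^ (2 * n) ∣ p) : p = 0 := by
  apply sparse_zero p (2 * n) (fun j => if (j : ℕ) < n then (j : ℕ) else n + j) ?_ ?_ h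
  · intro a b hab
    apply Fin.ext
    simp only at hab
    split_ifs at hab <;> omega
  · intro k hk
    by_cases h1 : k < n
    · exact absurd ⟨⟨k, by omega⟩, by simp [h1]⟩ hk
    by_cases h2 : k < 2 * n
    · exact hp1 k (by omega) h2
    by_cases h3 : k < 3 * n
    · exact absurd ⟨⟨k - n, by omega⟩, by
        show (if k - n < n then k - n else n + (k - n)) = k
        rw [if_neg (by omega)]; omega⟩ hk
    · exact hp2 k (by omega)

/-- The polynomial with coefficients `u` in degrees `< n` and `w` in degrees `n, …, 2n-1`. -/
def bpoly (n : ℕ) (u w : Fin n → ℝ) : Polynomial ℝ :=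
  ∑ j : Fin n, Polynomial.monomial (j : ℕ) (u j) +
    ∑ j : Fin n, Polynomial.monomial (n + (j : ℕ)) (w j)

lemma coeff_choose (n k : ℕ) (c : ℝ) (m : ℕ) :
    (Polynomial.monomial k c * (1 + Polynomial.X : Polynomial ℝ) ^ m).coeff n =
      if k ≤ n then c * (m.choose (n - k) : ℝ) else 0 := by
  rw [← Polynomial.C_mul_X_pow_eq_monomial, mul_assoc, Polynomial.coeff_C_mul,
    Polynomial.coeff_X_pow_mul']
  split_ifs <;> simp [Polynomial.coeff_one_add_X_pow]

lemma bpoly_coeff_lt (n : ℕ) (u w : Fin n → ℝ) (i : Fin n) :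
    (bpoly n u w).coeff i = u i := by
  unfold bpoly
  rw [Polynomial.coeff_add, Polynomial.finsetSum_coeff, Polynomial.finsetSum_coeff,
    Finset.sum_eq_single i, Finset.sum_eq_zero]
  · simp
  · intro j _
    rw [Polynomial.coeff_monomial, if_neg (by omega)]
  · intro j _ hj
    rw [Polynomial.coeff_monomial, if_neg (fun h => hj (Fin.ext h))]
  · simp

lemma bpoly_coeff_mid (n : ℕ) (u w : Fin n → ℝ) (i : Fin n) :
    (bpoly n u w).coeff (n + i) = w i := by
  unfold bpoly
  rw [Polynomial.coeff_add, Polynomial.finsetSum_coeff, Polynomial.finsetSum_coeff,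
    Finset.sum_eq_zero, Finset.sum_eq_single i]
  · simp
  · intro j _ hj
    rw [Polynomial.coeff_monomial, if_neg (fun h => hj (Fin.ext (by omega)))]
  · simp
  · intro j _
    rw [Polynomial.coeff_monomial, if_neg (by omega)]

lemma bpoly_coeff_ge (n : ℕ) (u w : Fin n → ℝ) (k : ℕ) (hk : 2 * n ≤ k) :
    (bpoly n u w).coeff k = 0 := by
  unfold bpoly
  rw [Polynomial.coeff_add, Polynomial.finsetSum_coeff, Polynomial.finsetSum_coeff,
    Finset.sum_eq_zero, Finset.sum_eq_zero, add_zero]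
  · intro j _
    rw [Polynomial.coeff_monomial, if_neg (by omega)]
  · intro j _
    rw [Polynomial.coeff_monomial, if_neg (by omega)]

lemma eq_bpoly (n : ℕ) (b : Polynomial ℝ) (hb : ∀ k, 2 * n ≤ k → b.coeff k = 0) :
    b = bpoly n (fun j => b.coeff j) (fun j => b.coeff (n + j)) := by
  ext k
  by_cases h1 : k < n
  · exact (bpoly_coeff_lt n (fun j => b.coeff j) (fun j => b.coeff (n + j)) ⟨k, h1⟩).symm
  by_cases h2 : k < 2 * n
  · obtain ⟨i, rfl⟩ : ∃ i, k = n + i := ⟨k - n, by omega⟩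
    exact (bpoly_coeff_mid n (fun j => b.coeff j) (fun j => b.coeff (n + j)) ⟨i, by omega⟩).symm
  · rw [hb k (by omega), bpoly_coeff_ge _ _ _ _ (by omega)]

lemma bmul_coeff_lt (n : ℕ) (u w : Fin n → ℝ) (i : Fin n) :
    (bpoly n u w * (1 + Polynomial.X : Polynomial ℝ) ^ (2 * n)).coeff i =
      (Dmat n *ᵥ u) i := by
  unfold bpoly
  rw [add_mul, Finset.sum_mul, Finset.sum_mul, Polynomial.coeff_add,
    Polynomial.finsetSum_coeff, Polynomial.finsetSum_coeff]
  simp only [coeff_choose, Matrix.mulVec, dotProduct, Dmat, Matrix.of_apply]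
  rw [Finset.sum_eq_zero (f := fun x : Fin n => if n + (x : ℕ) ≤ i then _ else _)
    (fun j _ => if_neg (by omega)), add_zero]
  refine Finset.sum_congr rfl fun j _ => ?_
  split_ifs <;> ring

lemma bmul_coeff_mid (n : ℕ) (u w : Fin n → ℝ) (i : Fin n) :
    (bpoly n u w * (1 + Polynomial.X : Polynomial ℝ) ^ (2 * n)).coeff (n + i) =
      (Nmat n *ᵥ u) i + (Dmat n *ᵥ w) i := by
  unfold bpoly
  rw [add_mul, Finset.sum_mul, Finset.sum_mul, Polynomial.coeff_add,
    Polynomial.finsetSum_coeff, Polynomial.finsetSum_coeff]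
  simp only [coeff_choose, Matrix.mulVec, dotProduct, Dmat, Nmat, Matrix.of_apply]
  congr 1
  · refine Finset.sum_congr rfl fun j _ => ?_
    rw [if_pos (by omega)]; ring
  · refine Finset.sum_congr rfl fun j _ => ?_
    rw [show n + (i : ℕ) - (n + j) = i - j by omega]
    by_cases h : (j : ℕ) ≤ i
    · rw [if_pos (by omega), if_pos h]; ring
    · rw [if_neg (by omega), if_neg h]; ring

lemma mul_coeff_large (n s : ℕ) (b : Polynomial ℝ) (hb : ∀ k, s ≤ k → b.coeff k = 0) (k : ℕ)
    (hk : s + 2 * n ≤ k) :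
    (b * (1 + Polynomial.X : Polynomial ℝ) ^ (2 * n)).coeff k = 0 := by
  rw [Polynomial.coeff_mul]
  refine Finset.sum_eq_zero fun x hx => ?_
  rw [Finset.HasAntidiagonal.mem_antidiagonal] at hx
  by_cases h : s ≤ x.1
  · rw [hb _ h, zero_mul]
  · rw [Polynomial.coeff_one_add_X_pow, Nat.choose_eq_zero_of_lt (by omega)]; simp

lemma Nmat_det (n : ℕ) : IsUnit (Nmat n).det := by
  rw [isUnit_iff_ne_zero]
  intro h0
  obtain ⟨u, hu, hu0⟩ := Matrix.exists_mulVec_eq_zero_iff.mpr h0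
  apply hu
  have hb : ∀ k, n ≤ k → (bpoly n u 0).coeff k = 0 := by
    intro k hk
    by_cases h2 : k < 2 * n
    · obtain ⟨i, rfl⟩ : ∃ i, k = n + i := ⟨k - n, by omega⟩
      exact bpoly_coeff_mid n u 0 ⟨i, by omega⟩
    · exact bpoly_coeff_ge n u 0 k (by omega)
  have hz := gap_zero n (bpoly n u 0 * (1 + Polynomial.X : Polynomial ℝ) ^ (2 * n))
    (by
      intro k hk h2
      obtain ⟨i, rfl⟩ : ∃ i, k = n + i := ⟨k - n, by omega⟩
      rw [bmul_coeff_mid n u 0 ⟨i, by omega⟩, hu0]; simp)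
    (by
      intro k hk
      exact mul_coeff_large n n _ hb k (by omega))
    (Dvd.intro_left _ rfl)
  have hne : (1 + Polynomial.X : Polynomial ℝ) ^ (2 * n) ≠ 0 := by
    apply pow_ne_zero
    rw [add_comm]
    exact Polynomial.X_add_C_ne_zero (1 : ℝ)
  have hb0 := (mul_eq_zero.mp hz).resolve_right hne
  funext i
  rw [← bpoly_coeff_lt n u 0 i, hb0]; simp

lemma Dmat_det (n : ℕ) : IsUnit (Dmat n).det := by
  rw [Matrix.det_of_isLowerTriangular]
  · simp [Dmat]
  · intro i j hij
    have : (i : ℕ) < j := hij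
    simp only [Dmat, Matrix.of_apply]
    rw [if_neg (by omega)]

lemma Jmat_apply (n : ℕ) (v : Fin n → ℝ) (i : Fin n) : (Jmat n *ᵥ v) i = v i.rev := by
  simp only [Matrix.mulVec, dotProduct, Jmat, Matrix.of_apply]
  rw [Finset.sum_eq_single i.rev]
  · rw [if_pos (by rw [Fin.val_rev]; omega)]; simp
  · intro j _ hj
    rw [if_neg (fun h => hj (Fin.ext (by rw [Fin.val_rev]; omega))), zero_mul]
  · simp

lemma Jmat_det (n : ℕ) : IsUnit (Jmat n).det := by
  rw [isUnit_iff_ne_zero]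
  intro h0
  obtain ⟨u, hu, hu0⟩ := Matrix.exists_mulVec_eq_zero_iff.mpr h0
  apply hu
  funext i
  have := congrFun hu0 i.rev
  rw [Jmat_apply] at this
  simpa using this

lemma Umat_det (n : ℕ) : IsUnit (Umat n).det := by
  unfold Umat
  rw [Matrix.det_mul, Matrix.det_mul, Matrix.det_mul]
  exact (((Jmat_det n).mul (Dmat_det n)).mul
    (Matrix.isUnit_nonsing_inv_det _ (Nmat_det n))).mul (Dmat_det n)

/-- One-variable membership condition. -/
def Good (n k : ℕ) (f : Polynomial ℝ) : Prop :=
  ∃ a b : Polynomial ℝ, (∀ i, 2 * n ≤ i + k → a.coeff i = 0) ∧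
    (∀ i, 2 * n ≤ i + k → b.coeff i = 0) ∧
    f = a * Polynomial.X ^ (2 * n) + b * (1 + Polynomial.X) ^ (2 * n)

lemma good_large (n k : ℕ) (hk : n ≤ k) (f : Polynomial ℝ)
    (hf : ∀ i, 2 * n ≤ i + k → f.coeff i = 0) (h : Good n k f) : f = 0 := by
  obtain ⟨a, b, ha, hb, h⟩ := h
  have hz := gap_zero n (f - a * Polynomial.X ^ (2 * n))
    (by
      intro i h1 h2
      rw [Polynomial.coeff_sub, Polynomial.coeff_mul_X_pow', if_neg (by omega),
        hf i (by omega), sub_zero])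
    (by
      intro i h1
      rw [Polynomial.coeff_sub, Polynomial.coeff_mul_X_pow', hf i (by omega)]
      split_ifs
      · rw [ha _ (by omega), sub_zero]
      · simp)
    ⟨b, by rw [h]; ring⟩
  ext i
  by_cases h1 : i < 2 * n
  · have := congrArg (fun p => Polynomial.coeff p i) hz
    simp only [Polynomial.coeff_sub, Polynomial.coeff_mul_X_pow'] at this
    rw [if_neg (by omega), sub_zero] at this
    exact this
  · rw [hf i (by omega)]; simp

lemma good_iff (n k : ℕ) (hk : k < n) (f : Polynomial ℝ)
    (hf : ∀ i, n ≤ i → f.coeff i = 0) :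
    Good n k f ↔ ∃ w : Fin n → ℝ, (∀ j : Fin n, n ≤ (j : ℕ) + k → w j = 0) ∧
      (fun i : Fin n => f.coeff i) = (Dmat n * (Nmat n)⁻¹ * Dmat n) *ᵥ w := by
  constructor
  · rintro ⟨a, b, ha, hb, h⟩
    have hb' := eq_bpoly n b (fun k hk => hb k (by omega))
    set u : Fin n → ℝ := fun j => b.coeff j with hu
    set w : Fin n → ℝ := fun j => b.coeff (n + j) with hw
    have h1 : (fun i : Fin n => f.coeff i) = Dmat n *ᵥ u := by
      funext i
      rw [h, Polynomial.coeff_add, Polynomial.coeff_mul_X_pow', if_neg (by omega), hb',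
        bmul_coeff_lt, zero_add]
    have h2 : Nmat n *ᵥ u + Dmat n *ᵥ w = 0 := by
      funext i
      rw [Pi.add_apply, ← bmul_coeff_mid, ← hb']
      have := hf (n + i) (by omega)
      rw [h, Polynomial.coeff_add, Polynomial.coeff_mul_X_pow', if_neg (by omega),
        zero_add] at this
      exact this
    refine ⟨-w, ?_, ?_⟩
    · intro j hj
      simp only [hw, Pi.neg_apply]
      rw [hb _ (by omega), neg_zero]
    · rw [h1, ← Matrix.mulVec_mulVec, ← Matrix.mulVec_mulVec, Matrix.mulVec_neg,
        ← eq_neg_of_add_eq_zero_left h2, Matrix.mulVec_mulVec _ (Nmat n)⁻¹,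
        Matrix.nonsing_inv_mul _ (Nmat_det n), Matrix.one_mulVec]
  · rintro ⟨w, hw, h⟩
    set u : Fin n → ℝ := (Nmat n)⁻¹ *ᵥ (Dmat n *ᵥ w) with hu
    set b := bpoly n u (-w) with hbdef
    have h1 : (fun i : Fin n => f.coeff i) = Dmat n *ᵥ u := by
      rw [h, hu]; simp only [Matrix.mulVec_mulVec, mul_assoc]
    have h2 : Nmat n *ᵥ u + Dmat n *ᵥ (-w) = 0 := by
      rw [hu, Matrix.mulVec_mulVec _ (Nmat n), Matrix.mul_nonsing_inv _ (Nmat_det n),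
        Matrix.one_mulVec, Matrix.mulVec_neg, add_neg_cancel]
    have hdvd : (Polynomial.X : Polynomial ℝ) ^ (2 * n) ∣
        f - b * (1 + Polynomial.X) ^ (2 * n) := by
      rw [Polynomial.X_pow_dvd_iff]
      intro d hd
      rw [Polynomial.coeff_sub]
      by_cases hdn : d < n
      · rw [hbdef, bmul_coeff_lt n u (-w) ⟨d, hdn⟩, ← h1]; simp
      · obtain ⟨i, rfl⟩ : ∃ i, d = n + i := ⟨d - n, by omega⟩
        rw [hbdef, bmul_coeff_mid n u (-w) ⟨i, by omega⟩, ← Pi.add_apply, h2, hf _ (by omega)]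
        simp
    have hb : ∀ i, n ≤ i → 2 * n ≤ i + k → b.coeff i = 0 := by
      intro i hin hi
      by_cases hi2 : i < 2 * n
      · obtain ⟨j, rfl⟩ : ∃ j, i = n + j := ⟨i - n, by omega⟩
        rw [hbdef, bpoly_coeff_mid n u (-w) ⟨j, by omega⟩, Pi.neg_apply, hw _ (by simp; omega),
          neg_zero]
      · exact bpoly_coeff_ge n u _ i (by omega)
    have hb' : ∀ i, 2 * n - k ≤ i → b.coeff i = 0 := fun i hi => hb i (by omega) (by omega)
    obtain ⟨a, ha⟩ := hdvd
    refine ⟨a, b, ?_, fun i hi => hb' i (by omega), ?_⟩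
    · intro i hi
      have h3 := congrArg (fun p => Polynomial.coeff p (i + 2 * n)) ha
      simp only [Polynomial.coeff_sub] at h3
      rw [mul_comm _ a, Polynomial.coeff_mul_X_pow, hf _ (by omega),
        mul_coeff_large n (2 * n - k) b hb' _ (by omega), sub_zero] at h3
      exact h3.symm
    · rw [mul_comm a, ← ha]; ring

/-! ### Dehomogenization -/

/-- Set `y = 1`, `x = t` and view the result as a polynomial in `z` over `ℝ[t]`. -/
def psi : R3 →ₐ[ℝ] Polynomial (Polynomial ℝ) :=
  aeval ![Polynomial.C Polynomial.X, 1, Polynomial.X]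

/-- The coefficient of `x^i z^k` after `y = 1`. -/
def pc (p : R3) (k i : ℕ) : ℝ := ((psi p).coeff k).coeff i

lemma psi_monomial (d : Fin 3 →₀ ℕ) (c : ℝ) :
    psi (monomial d c) = Polynomial.monomial (d 2) (Polynomial.monomial (d 0) c) := by
  unfold psi
  rw [aeval_monomial, Finsupp.prod_fintype _ _ (by simp), Fin.prod_univ_three]
  simp only [Matrix.cons_val_zero, Matrix.cons_val_one, Matrix.cons_val, one_pow, mul_one]
  rw [← Polynomial.C_mul_X_pow_eq_monomial, ← Polynomial.C_mul_X_pow_eq_monomial,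
    Polynomial.C_mul, Polynomial.C_pow, ← mul_assoc]
  rfl

lemma pc_add (p q : R3) (k i : ℕ) : pc (p + q) k i = pc p k i + pc q k i := by
  simp [pc]

lemma pc_sub (p q : R3) (k i : ℕ) : pc (p - q) k i = pc p k i - pc q k i := by
  simp [pc]

lemma pc_smul (c : ℝ) (p : R3) (k i : ℕ) : pc (c • p) k i = c * pc p k i := by
  simp [pc]

lemma pc_sum {ι : Type*} (s : Finset ι) (f : ι → R3) (k i : ℕ) :
    pc (∑ j ∈ s, f j) k i = ∑ j ∈ s, pc (f j) k i := by
  simp [pc, Polynomial.finsetSum_coeff]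

lemma pc_monomial (d : Fin 3 →₀ ℕ) (c : ℝ) (k i : ℕ) :
    pc (monomial d c) k i = if d 2 = k ∧ d 0 = i then c else 0 := by
  unfold pc
  rw [psi_monomial, Polynomial.coeff_monomial]
  by_cases h : d 2 = k
  · simp [h, Polynomial.coeff_monomial]
  · simp [h]

lemma pc_eq (p : R3) (k i : ℕ) :
    pc p k i = ∑ d ∈ p.support, if d 2 = k ∧ d 0 = i then coeff d p else 0 := by
  conv_lhs => rw [p.as_sum]
  rw [pc_sum]
  simp only [pc_monomial]

lemma degree_three (d : Fin 3 →₀ ℕ) : d.degree = d 0 + d 1 + d 2 := by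
  rw [Finsupp.degree_eq_sum, Fin.sum_univ_three]

lemma pc_zero_of_lt {p : R3} {N : ℕ} (hp : p.IsHomogeneous N) (k i : ℕ) (h : N < i + k) :
    pc p k i = 0 := by
  rw [pc_eq]
  refine Finset.sum_eq_zero fun d hd => ?_
  have h1 : d.degree = N := (hp.degree_eq_sum_deg_support hd).symm
  rw [degree_three] at h1
  rw [if_neg (by omega)]

lemma pc_eq_coeff {p : R3} {N : ℕ} (hp : p.IsHomogeneous N) (d : Fin 3 →₀ ℕ)
    (hd : d.degree = N) : pc p (d 2) (d 0) = coeff d p := by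
  rw [pc_eq, Finset.sum_eq_single d]
  · simp
  · intro e he hne
    have h1 : e.degree = N := (hp.degree_eq_sum_deg_support he).symm
    rw [degree_three] at h1 hd
    rw [if_neg]
    rintro ⟨h2, h3⟩
    apply hne
    ext j
    fin_cases j
    · exact h3
    · show e 1 = d 1
      omega
    · exact h2
  · intro h
    simpa using h

lemma hom_ext {p q : R3} {N : ℕ} (hp : p.IsHomogeneous N) (hq : q.IsHomogeneous N)
    (h : ∀ k i, i + k ≤ N → pc p k i = pc q k i) : p = q := by
  ext d
  by_cases hd : d.degree = N
  · rw [← pc_eq_coeff hp d hd, ← pc_eq_coeff hq d hd]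
    apply h
    rw [degree_three] at hd
    omega
  · rw [hp.coeff_eq_zero hd, hq.coeff_eq_zero hd]

/-- Exponent vector. -/
def ev (i j k : ℕ) : Fin 3 →₀ ℕ := Finsupp.equivFunOnFinite.symm ![i, j, k]

@[simp] lemma ev0 (i j k : ℕ) : ev i j k 0 = i := rfl
@[simp] lemma ev1 (i j k : ℕ) : ev i j k 1 = j := rfl
@[simp] lemma ev2 (i j k : ℕ) : ev i j k 2 = k := rfl

/-- The homogeneous polynomial of degree `N` with given coefficients. -/
def hmg (N : ℕ) (c : ℕ → ℕ → ℝ) : R3 :=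
  ∑ k ∈ Finset.range (N + 1), ∑ i ∈ Finset.range (N + 1 - k),
    monomial (ev i (N - i - k) k) (c k i)

lemma hmg_hom (N : ℕ) (c : ℕ → ℕ → ℝ) : (hmg N c).IsHomogeneous N := by
  refine IsHomogeneous.sum _ _ _ fun k hk => IsHomogeneous.sum _ _ _ fun i hi => ?_
  apply isHomogeneous_monomial
  rw [Finset.mem_range] at hk hi
  rw [degree_three]
  simp only [ev0, ev1, ev2]
  omega

lemma pc_hmg (N : ℕ) (c : ℕ → ℕ → ℝ) (k i : ℕ) (h : i + k ≤ N) : pc (hmg N c) k i = c k i := by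
  unfold hmg
  simp only [pc_sum, pc_monomial, ev0, ev2]
  rw [Finset.sum_eq_single k, Finset.sum_eq_single i]
  · simp
  · intro j _ hj
    simp [hj]
  · intro h1
    exact absurd (Finset.mem_range.mpr (by omega)) h1
  · intro j _ hj
    simp [hj]
  · intro h1
    exact absurd (Finset.mem_range.mpr (by omega)) h1

lemma psi_hmg_coeff (N : ℕ) (c : ℕ → Polynomial ℝ)
    (hc : ∀ k i, N < i + k → (c k).coeff i = 0) (k : ℕ) :
    (psi (hmg N fun k i => (c k).coeff i)).coeff k = c k := by
  ext i
  by_cases h : i + k ≤ N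
  · exact pc_hmg N (fun k i => (c k).coeff i) k i h
  · rw [hc k i (by omega)]
    exact pc_zero_of_lt (hmg_hom N _) k i (by omega)

attribute [local instance] MvPolynomial.gradedAlgebra

lemma comp_mul (A q : R3) (i j : ℕ) (hq : q.IsHomogeneous j) :
    homogeneousComponent (i + j) (A * q) = homogeneousComponent i A * q := by
  have := DirectSum.coe_decompose_mul_add_of_right_mem (homogeneousSubmodule (Fin 3) ℝ)
    (i := i) (j := j) (a := A) (b := q) hq
  rw [← decomposition.decompose'_apply, ← decomposition.decompose'_apply]
  exact this

lemma mem_J1_iff (n : ℕ) (hn : 1 ≤ n) (F : R3) (hF : F.IsHomogeneous (2 * n - 1)) :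
    (X 1 : R3) ^ (2 * n) * F ∈ J1 (2 * n - 1) ↔ ∀ k, Good n k ((psi F).coeff k) := by
  have hx : ((X 0 : R3) ^ (2 * n)).IsHomogeneous (2 * n) := isHomogeneous_X_pow _ _
  have hy : ((X 1 : R3) ^ (2 * n)).IsHomogeneous (2 * n) := isHomogeneous_X_pow _ _
  have hxy : (((X 0 : R3) + X 1) ^ (2 * n)).IsHomogeneous (2 * n) := by
    simpa using ((isHomogeneous_X ℝ (0 : Fin 3)).add (isHomogeneous_X ℝ (1 : Fin 3))).pow (2 * n)
  have hpsi : ∀ A B : R3, ∀ k, (psi (A * X 0 ^ (2 * n) + B * (X 0 + X 1) ^ (2 * n))).coeff k =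
      (psi A).coeff k * Polynomial.X ^ (2 * n) +
        (psi B).coeff k * (1 + Polynomial.X) ^ (2 * n) := by
    intro A B k
    have h0 : psi (X 0) = Polynomial.C Polynomial.X := by simp [psi]
    have h1 : psi (X 1) = 1 := by simp [psi]
    rw [map_add, map_mul, map_mul, map_pow, map_pow, map_add, h0, h1,
      show (Polynomial.C Polynomial.X + 1 : Polynomial (Polynomial ℝ)) =
        Polynomial.C (1 + Polynomial.X) by simp [add_comm],
      ← Polynomial.C_pow, ← Polynomial.C_pow, Polynomial.coeff_add, Polynomial.coeff_mul_C,
      Polynomial.coeff_mul_C]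
  have hpsiF : psi ((X 1 : R3) ^ (2 * n) * F) = psi F := by
    have h1 : psi (X 1) = 1 := by simp [psi]
    rw [map_mul, map_pow, h1, one_pow, one_mul]
  unfold J1
  rw [show 2 * n - 1 + 1 = 2 * n by omega, Ideal.mem_span_pair]
  constructor
  · rintro ⟨A, B, h⟩ k
    have h2 := congrArg (homogeneousComponent (2 * n - 1 + 2 * n)) h
    rw [map_add, comp_mul _ _ _ _ hx, comp_mul _ _ _ _ hxy, mul_comm (X 1 ^ (2 * n)) F,
      comp_mul _ _ _ _ hy, homogeneousComponent_eq_self hF, mul_comm F] at h2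
    have hA := homogeneousComponent_isHomogeneous (2 * n - 1) A
    have hB := homogeneousComponent_isHomogeneous (2 * n - 1) B
    refine ⟨(psi (homogeneousComponent (2 * n - 1) A)).coeff k,
      (psi (homogeneousComponent (2 * n - 1) B)).coeff k, ?_, ?_, ?_⟩
    · intro i hi
      exact pc_zero_of_lt hA k i (by omega)
    · intro i hi
      exact pc_zero_of_lt hB k i (by omega)
    · rw [← hpsi, h2, hpsiF]
  · intro h
    choose a b ha hb hab using h
    refine ⟨hmg (2 * n - 1) fun k i => (a k).coeff i, hmg (2 * n - 1) fun k i => (b k).coeff i, ?_⟩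
    apply hom_ext (N := 2 * n - 1 + 2 * n)
    · exact ((hmg_hom _ _).mul hx).add ((hmg_hom _ _).mul hxy)
    · rw [mul_comm]
      exact hF.mul hy
    · intro k i _
      unfold pc
      rw [hpsi, psi_hmg_coeff _ _ (fun k i h => ha k i (by omega)),
        psi_hmg_coeff _ _ (fun k i h => hb k i (by omega)), ← hab, hpsiF]

/-! ### Swapping `x` and `z` -/

/-- The swap `x ↔ z`. -/
def sw : R3 →ₐ[ℝ] R3 := rename (Equiv.swap (0 : Fin 3) 2)

lemma sw_sw (p : R3) : sw (sw p) = p := by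
  unfold sw
  rw [rename_rename]
  simp [← Equiv.coe_trans]

lemma sw0 : sw (X 0) = X 2 := by simp [sw]
lemma sw1 : sw (X 1) = X 1 := by
  simp only [sw, rename_X]
  rfl
lemma sw2 : sw (X 2) = X 0 := by simp [sw]

lemma sw_hom {p : R3} {N : ℕ} (hp : p.IsHomogeneous N) : (sw p).IsHomogeneous N :=
  hp.rename_isHomogeneous

lemma pc_sw (p : R3) (k i : ℕ) : pc (sw p) k i = pc p i k := by
  induction p using MvPolynomial.induction_on' with
  | monomial d c =>
    have h : sw (monomial d c) = monomial (ev (d 2) (d 1) (d 0)) c := by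
      rw [sw, rename_monomial]
      have he : Finsupp.mapDomain (Equiv.swap (0 : Fin 3) 2) d = ev (d 2) (d 1) (d 0) := by
        ext j
        rw [Finsupp.mapDomain_equiv_apply]
        fin_cases j <;> rfl
      rw [he]
    rw [h, pc_monomial, pc_monomial]
    simp only [ev0, ev2]
    exact if_congr and_comm rfl rfl
  | add p q hp hq => rw [map_add, pc_add, pc_add, hp, hq]

lemma mem_J2_iff (r : ℕ) (p : R3) : p ∈ J2 r ↔ sw p ∈ J1 r := by
  unfold J1 J2
  rw [Ideal.mem_span_pair, Ideal.mem_span_pair]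
  constructor
  · rintro ⟨a, b, rfl⟩
    refine ⟨sw a, sw b, ?_⟩
    simp only [map_add, map_mul, map_pow, sw0, sw1, sw2]
  · rintro ⟨a, b, h⟩
    refine ⟨sw a, sw b, ?_⟩
    rw [← sw_sw p, ← h]
    simp only [map_add, map_mul, map_pow, sw0, sw1, sw2]

/-! ### Matrices -/

/-- Coefficient array of a matrix, with reversed indices. -/
def cM {n : ℕ} (M : Matrix (Fin n) (Fin n) ℝ) (k i : ℕ) : ℝ :=
  if h : i < n ∧ k < n then M (Fin.rev ⟨i, h.1⟩) (Fin.rev ⟨k, h.2⟩) else 0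

/-- The polynomial attached to a matrix. -/
def Phi (n : ℕ) : Matrix (Fin n) (Fin n) ℝ →ₗ[ℝ] R3 where
  toFun M := hmg (2 * n - 1) (cM M)
  map_add' M M' := by
    apply hom_ext (hmg_hom _ _) ((hmg_hom _ _).add (hmg_hom _ _))
    intro k i h
    rw [pc_add, pc_hmg _ _ _ _ h, pc_hmg _ _ _ _ h, pc_hmg _ _ _ _ h]
    unfold cM
    split_ifs <;> simp
  map_smul' c M := by
    apply hom_ext (hmg_hom _ _) ((homogeneousSubmodule (Fin 3) ℝ _).smul_mem _ (hmg_hom _ _))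
    intro k i h
    rw [RingHom.id_apply, pc_smul, pc_hmg _ _ _ _ h, pc_hmg _ _ _ _ h]
    unfold cM
    split_ifs <;> simp

lemma Phi_hom (n : ℕ) (M : Matrix (Fin n) (Fin n) ℝ) : (Phi n M).IsHomogeneous (2 * n - 1) :=
  hmg_hom _ _

lemma pc_Phi (n : ℕ) (M : Matrix (Fin n) (Fin n) ℝ) (k i : ℕ) : pc (Phi n M) k i = cM M k i := by
  by_cases h : i + k ≤ 2 * n - 1
  · exact pc_hmg _ _ _ _ h
  · rw [pc_zero_of_lt (Phi_hom n M) k i (by omega), cM, dif_neg (by omega)]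

lemma Phi_inj (n : ℕ) (M : Matrix (Fin n) (Fin n) ℝ) (h : Phi n M = 0) : M = 0 := by
  ext a b
  have h1 := pc_Phi n M (b.rev : ℕ) (a.rev : ℕ)
  rw [h, cM, dif_pos ⟨a.rev.2, b.rev.2⟩] at h1
  simp only [Fin.eta, Fin.rev_rev] at h1
  rw [← h1]; simp [pc]

lemma sw_Phi (n : ℕ) (M : Matrix (Fin n) (Fin n) ℝ) : sw (Phi n M) = Phi n Mᵀ := by
  apply hom_ext (sw_hom (Phi_hom n M)) (Phi_hom n _)
  intro k i _
  rw [pc_sw, pc_Phi, pc_Phi]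
  unfold cM
  by_cases h : i < n ∧ k < n
  · rw [dif_pos h, dif_pos h.symm]; rfl
  · rw [dif_neg h, dif_neg (fun h' => h h'.symm)]

lemma Phi_J1 (n : ℕ) (hn : 1 ≤ n) (M : Matrix (Fin n) (Fin n) ℝ) :
    (X 1 : R3) ^ (2 * n) * Phi n M ∈ J1 (2 * n - 1) ↔
      ∃ A : Matrix (Fin n) (Fin n) ℝ, (∀ i j : Fin n, j < i → A i j = 0) ∧ M = Umat n * A := by
  rw [mem_J1_iff n hn _ (Phi_hom n M)]
  have hcol : ∀ (b : Fin n) (w : Fin n → ℝ),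
      ((fun i : Fin n => ((psi (Phi n M)).coeff b.rev).coeff i) =
        (Dmat n * (Nmat n)⁻¹ * Dmat n) *ᵥ w) ↔ (fun a => M a b) = Umat n *ᵥ w := by
    intro b w
    have h1 : Umat n *ᵥ w = Jmat n *ᵥ ((Dmat n * (Nmat n)⁻¹ * Dmat n) *ᵥ w) := by
      rw [Matrix.mulVec_mulVec]; simp only [Umat, mul_assoc]
    have h2 : ∀ i : Fin n, ((psi (Phi n M)).coeff b.rev).coeff i = M i.rev b := by
      intro i
      have := pc_Phi n M b.rev i
      rw [cM, dif_pos ⟨i.2, b.rev.2⟩] at this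
      simp only [Fin.eta, Fin.rev_rev] at this
      exact this
    simp only [h2, h1]
    constructor
    · intro h
      funext a
      rw [Jmat_apply, ← h]; simp
    · intro h
      funext a
      have := congrFun h a.rev
      rw [Jmat_apply] at this
      simpa using this
  have hfz : ∀ k i, n ≤ i → ((psi (Phi n M)).coeff k).coeff i = 0 := by
    intro k i hi
    have := pc_Phi n M k i
    rw [cM, dif_neg (by omega)] at this
    exact this
  constructor
  · intro h
    have h' : ∀ b : Fin n, ∃ w : Fin n → ℝ, (∀ j : Fin n, b < j → w j = 0) ∧
        (fun a => M a b) = Umat n *ᵥ w := by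
      intro b
      obtain ⟨w, hw, hw2⟩ := (good_iff n b.rev b.rev.2 _ (hfz _)).mp (h b.rev)
      refine ⟨w, ?_, (hcol b w).mp hw2⟩
      intro j hj
      apply hw
      have : (b : ℕ) < j := hj
      rw [Fin.val_rev]
      omega
    choose w hw hw2 using h'
    refine ⟨Matrix.of fun i j => w j i, fun i j hij => hw j i hij, ?_⟩
    ext a b
    exact congrFun (hw2 b) a
  · rintro ⟨A, hA, hM⟩ k
    by_cases hk : k < n
    · have hk' : k = ((Fin.rev ⟨k, hk⟩ : Fin n).rev : ℕ) := by simp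
      rw [good_iff n k hk _ (hfz _)]
      refine ⟨fun i => A i (Fin.rev ⟨k, hk⟩), ?_, ?_⟩
      · intro j hj
        apply hA
        rw [Fin.lt_def, Fin.val_rev]
        simp only
        omega
      · have := (hcol (Fin.rev ⟨k, hk⟩) (fun i => A i (Fin.rev ⟨k, hk⟩))).mpr (by
          rw [hM]; rfl)
        rw [← hk'] at this
        exact this
    · have : (psi (Phi n M)).coeff k = 0 := by
        ext i
        have := pc_Phi n M k i
        rw [cM, dif_neg (by omega)] at this
        exact this
      rw [this]
      exact ⟨0, 0, by simp, by simp, by simp⟩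

lemma mem_K_iff (n : ℕ) (hn : 1 ≤ n) (F : R3) :
    F ∈ K (2 * n - 1) ↔ F.IsHomogeneous (2 * n - 1) ∧
      (X 1 : R3) ^ (2 * n) * F ∈ J1 (2 * n - 1) ∧ (X 1 : R3) ^ (2 * n) * sw F ∈ J1 (2 * n - 1) := by
  unfold K
  rw [Submodule.mem_inf, Submodule.mem_comap, mem_homogeneousSubmodule,
    Submodule.restrictScalars_mem, Ideal.mem_inf, mem_J2_iff, LinearMap.mulLeft_apply, map_mul,
    map_pow, sw1, show 2 * n - 1 + 1 = 2 * n by omega]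

lemma pc_zero_of_ge (n : ℕ) (hn : 1 ≤ n) (F : R3) (hF : F.IsHomogeneous (2 * n - 1))
    (h : (X 1 : R3) ^ (2 * n) * F ∈ J1 (2 * n - 1)) (k i : ℕ) (hk : n ≤ k) : pc F k i = 0 := by
  have h1 := good_large n k hk ((psi F).coeff k)
    (fun i hi => pc_zero_of_lt hF k i (by omega)) ((mem_J1_iff n hn F hF).mp h k)
  rw [pc, h1]; simp

lemma mem_K_iff' (n : ℕ) (hn : 1 ≤ n) (F : R3) :
    F ∈ K (2 * n - 1) ↔ ∃ A B : Matrix (Fin n) (Fin n) ℝ, (∀ i j : Fin n, j < i → A i j = 0) ∧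
      (∀ i j : Fin n, j < i → B i j = 0) ∧ Umat n * A = Bᵀ * (Umat n)ᵀ ∧
      F = Phi n (Umat n * A) := by
  rw [mem_K_iff n hn]
  constructor
  · rintro ⟨hF, h1, h2⟩
    have hM : F = Phi n (Matrix.of fun a b => pc F b.rev a.rev) := by
      apply hom_ext hF (Phi_hom n _)
      intro k i _
      rw [pc_Phi]
      unfold cM
      split_ifs with h
      · rw [Matrix.of_apply, Fin.rev_rev, Fin.rev_rev]
      · by_cases hk : n ≤ k
        · exact pc_zero_of_ge n hn F hF h1 k i hk
        · rw [← pc_sw]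
          exact pc_zero_of_ge n hn _ (sw_hom hF) h2 i k (by omega)
    set M : Matrix (Fin n) (Fin n) ℝ := Matrix.of fun a b => pc F b.rev a.rev
    rw [hM, Phi_J1 n hn] at h1
    rw [hM, sw_Phi, Phi_J1 n hn] at h2
    obtain ⟨A, hA, hA2⟩ := h1
    obtain ⟨B, hB, hB2⟩ := h2
    refine ⟨A, B, hA, hB, ?_, ?_⟩
    · rw [← hA2, ← Matrix.transpose_mul, ← hB2, Matrix.transpose_transpose]
    · rw [← hA2]; exact hM
  · rintro ⟨A, B, hA, hB, hAB, rfl⟩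
    refine ⟨Phi_hom n _, (Phi_J1 n hn _).mpr ⟨A, hA, rfl⟩, ?_⟩
    rw [sw_Phi]
    refine (Phi_J1 n hn _).mpr ⟨B, hB, ?_⟩
    rw [hAB, Matrix.transpose_mul, Matrix.transpose_transpose, Matrix.transpose_transpose]

/-! ### Dimension count -/

/-- Index pairs on or above the diagonal. -/
abbrev UIdx (n : ℕ) : Type := Σ j : Fin n, {i : Fin n // i ≤ j}

lemma card_UIdx (n : ℕ) : 2 * Fintype.card (UIdx n) = n * n + n := by
  rw [Fintype.card_sigma]
  have h : ∀ j : Fin n, Fintype.card {i : Fin n // i ≤ j} = (j : ℕ) + 1 := by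
    intro j
    rw [Fintype.card_subtype]
    have : (Finset.univ.filter fun i : Fin n => i ≤ j) = Finset.Iic j := by ext; simp
    rw [this, Fin.card_Iic]
  simp only [h]
  rw [Fin.sum_univ_eq_sum_range (fun j => j + 1) n]
  induction n with
  | zero => simp
  | succ n ih =>
    rw [Finset.sum_range_succ, mul_add, ih]
    · ring
    · intro j
      rw [Fintype.card_subtype]
      have : (Finset.univ.filter fun i : Fin n => i ≤ j) = Finset.Iic j := by ext; simp
      rw [this, Fin.card_Iic]

/-- The upper-triangular matrix with the given entries. -/
def upp (n : ℕ) : (UIdx n → ℝ) →ₗ[ℝ] Matrix (Fin n) (Fin n) ℝ where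
  toFun f := Matrix.of fun i j => if h : i ≤ j then f ⟨j, i, h⟩ else 0
  map_add' f g := by
    ext i j
    simp only [Matrix.of_apply, Matrix.add_apply]
    split_ifs <;> simp
  map_smul' c f := by
    ext i j
    simp only [Matrix.of_apply, Matrix.smul_apply]
    split_ifs <;> simp

lemma upp_apply (n : ℕ) (f : UIdx n → ℝ) (i j : Fin n) :
    upp n f i j = if h : i ≤ j then f ⟨j, i, h⟩ else 0 := rfl

lemma upp_tri (n : ℕ) (f : UIdx n → ℝ) (i j : Fin n) (h : j < i) : upp n f i j = 0 := by
  rw [upp_apply, dif_neg (not_le.mpr h)]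

lemma upp_surj (n : ℕ) (A : Matrix (Fin n) (Fin n) ℝ) (hA : ∀ i j : Fin n, j < i → A i j = 0) :
    ∃ f, upp n f = A := by
  refine ⟨fun s => A s.2.1 s.1, ?_⟩
  ext i j
  rw [upp_apply]
  split_ifs with h
  · rfl
  · exact (hA i j (not_le.mp h)).symm

lemma upp_inj (n : ℕ) (f : UIdx n → ℝ) (h : upp n f = 0) : f = 0 := by
  funext ⟨j, i, hij⟩
  have := congrFun (congrFun h i) j
  rw [upp_apply, dif_pos hij] at this
  exact this

/-- The linear map `(X, Y) ↦ 𝒰 X - Yᵀ 𝒰ᵀ`. -/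
def Lmap (n : ℕ) : ((UIdx n → ℝ) × (UIdx n → ℝ)) →ₗ[ℝ] Matrix (Fin n) (Fin n) ℝ where
  toFun p := Umat n * upp n p.1 - (upp n p.2)ᵀ * (Umat n)ᵀ
  map_add' p q := by
    simp only [Prod.fst_add, Prod.snd_add, map_add, Matrix.mul_add, Matrix.transpose_add,
      Matrix.add_mul]
    abel
  map_smul' c p := by
    simp only [Prod.smul_fst, Prod.smul_snd, map_smul, Matrix.mul_smul, Matrix.transpose_smul,
      Matrix.smul_mul, RingHom.id_apply, smul_sub]

lemma Lmap_apply (n : ℕ) (p : (UIdx n → ℝ) × (UIdx n → ℝ)) :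
    Lmap n p = Umat n * upp n p.1 - (upp n p.2)ᵀ * (Umat n)ᵀ := rfl

/-- The linear map `X ↦ Φ(𝒰 X)`. -/
def Emap (n : ℕ) : ((UIdx n → ℝ) × (UIdx n → ℝ)) →ₗ[ℝ] R3 where
  toFun p := Phi n (Umat n * upp n p.1)
  map_add' p q := by
    simp only [Prod.fst_add, map_add, Matrix.mul_add]
  map_smul' c p := by
    simp only [Prod.smul_fst, map_smul, Matrix.mul_smul, RingHom.id_apply]

lemma Emap_apply (n : ℕ) (p : (UIdx n → ℝ) × (UIdx n → ℝ)) :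
    Emap n p = Phi n (Umat n * upp n p.1) := rfl

lemma Umat_cancel (n : ℕ) (A : Matrix (Fin n) (Fin n) ℝ) (h : Umat n * A = 0) : A = 0 := by
  have := congrArg (fun B => (Umat n)⁻¹ * B) h
  simpa [← mul_assoc, Matrix.nonsing_inv_mul _ (Umat_det n)] using this

lemma finrank_K (n : ℕ) (hn : 1 ≤ n) :
    Module.finrank ℝ (K (2 * n - 1)) = Module.finrank ℝ (LinearMap.ker (Lmap n)) := by
  have hK : K (2 * n - 1) = LinearMap.range ((Emap n).domRestrict (LinearMap.ker (Lmap n))) := by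
    ext F
    rw [mem_K_iff' n hn, LinearMap.mem_range]
    constructor
    · rintro ⟨A, B, hA, hB, hAB, rfl⟩
      obtain ⟨f, rfl⟩ := upp_surj n A hA
      obtain ⟨g, rfl⟩ := upp_surj n B hB
      exact ⟨⟨(f, g), by rw [LinearMap.mem_ker, Lmap_apply, sub_eq_zero]; exact hAB⟩, rfl⟩
    · rintro ⟨⟨p, hp⟩, rfl⟩
      rw [LinearMap.mem_ker, Lmap_apply, sub_eq_zero] at hp
      exact ⟨upp n p.1, upp n p.2, upp_tri n _, upp_tri n _, hp, rfl⟩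
  rw [hK]
  apply LinearMap.finrank_range_of_inj
  rw [← LinearMap.ker_eq_bot, LinearMap.ker_eq_bot']
  rintro ⟨⟨f, g⟩, hp⟩ h
  have h0 : Phi n (Umat n * upp n f) = 0 := h
  have h1 := Phi_inj n _ h0
  rw [LinearMap.mem_ker, Lmap_apply] at hp
  simp only [h1, zero_sub, neg_eq_zero] at hp
  have h2 : Umat n * upp n g = 0 := by
    rw [← Matrix.transpose_mul] at hp
    exact Matrix.transpose_eq_zero.mp hp
  have hf := upp_inj n f (Umat_cancel n _ h1)
  have hg := upp_inj n g (Umat_cancel n _ h2)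
  subst hf hg
  rfl

/-- Proposition 3.4: `dim_ℝ K(2n−1) = n` if and only if for every `n × n` real
matrix `C` the equation `𝒰·X − Yᵀ·𝒰ᵀ = C` has a solution consisting of two
upper-triangular matrices `X, Y`. -/
theorem prop_3_4 (n : ℕ) (hn : 1 ≤ n) :
    Module.finrank ℝ (K (2 * n - 1)) = n ↔
      ∀ C : Matrix (Fin n) (Fin n) ℝ,
        ∃ X Y : Matrix (Fin n) (Fin n) ℝ,
          (∀ i j : Fin n, j < i → X i j = 0) ∧
          (∀ i j : Fin n, j < i → Y i j = 0) ∧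
          Umat n * X - Yᵀ * (Umat n)ᵀ = C := by
  have hrn := (Lmap n).finrank_range_add_finrank_ker
  have hdim : Module.finrank ℝ ((UIdx n → ℝ) × (UIdx n → ℝ)) = n * n + n := by
    rw [Module.finrank_prod, Module.finrank_pi, ← two_mul, card_UIdx]
  have hmat : Module.finrank ℝ (Matrix (Fin n) (Fin n) ℝ) = n * n := by
    simp [Module.finrank_matrix]
  rw [hdim] at hrn
  rw [finrank_K n hn]
  have hiff : Module.finrank ℝ (LinearMap.ker (Lmap n)) = n ↔ LinearMap.range (Lmap n) = ⊤ := by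
    constructor
    · intro h
      apply Submodule.eq_top_of_finrank_eq
      omega
    · intro h
      rw [h, finrank_top] at hrn
      omega
  rw [hiff, LinearMap.range_eq_top]
  constructor
  · intro h C
    obtain ⟨p, hp⟩ := h C
    exact ⟨upp n p.1, upp n p.2, upp_tri n _, upp_tri n _, hp⟩
  · intro h C
    obtain ⟨A, B, hA, hB, hAB⟩ := h C
    obtain ⟨f, rfl⟩ := upp_surj n A hA
    obtain ⟨g, rfl⟩ := upp_surj n B hB
    exact ⟨(f, g), hAB⟩

end
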